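/- Let p be a prime, M an abelian group, and φ : M → M^{⊗p} an additive map all of whose values are fixed by σ_1 (i.e. σ_1 ∘ φ = φ). Then for every n ≥ 1 the higher Frobenius φ_{n−1} : M^{⊗p^{n−1}} → M^{⊗p^n} satisfies φ_{n−1} ∘ σ_{n−1} = σ_n ∘ φ_{n−1}, where σ_{n−1} and σ_n act on M^{⊗p^{n−1}} and M^{⊗p^n} respectively by reindexing. In particular, φ_{n−1} maps σ_{n−1}-invariant elements to σ_n-invariant elements. -/

import Mathlib

open scoped TensorProduct

section Digits

/-- Identification of digit tuples `(Fin p)^m` (first digit most significant) with `Fin (p^m)`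
via base-`p` digits. -/
def msbEquiv (p m : ℕ) : (Fin m → Fin p) ≃ Fin (p ^ m) :=
  (Equiv.piCongrLeft' (fun _ => Fin p) Fin.revPerm).trans finFunctionFinEquiv

/-- The digit rotation `τ_m : (i_1, …, i_m) ↦ (i_m, i_1, …, i_{m-1})` of digit tuples. -/
def rotPerm (p m : ℕ) [NeZero m] : Equiv.Perm (Fin m → Fin p) :=
  Equiv.piCongrLeft' (fun _ => Fin p) (Equiv.addRight (1 : Fin m))

/-- The permutation of `Fin (p^m)` corresponding to a permutation of digit tuples. -/
def digitPerm (p m : ℕ) (e : Equiv.Perm (Fin m → Fin p)) : Equiv.Perm (Fin (p ^ m)) :=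
  Equiv.permCongr (msbEquiv p m) e

end Digits

noncomputable section Tensor

/-- The `m`-fold tensor power over `ℤ` of an abelian group `A`, indexed by `Fin m`. -/
abbrev Tp (A : Type*) [AddCommGroup A] (m : ℕ) : Type _ := ⨂[ℤ] _ : Fin m, A

/-- The action of a permutation `e` of `Fin m` on the tensor power, by reindexing. -/
def permT (A : Type*) [AddCommGroup A] (m : ℕ) (e : Equiv.Perm (Fin m)) :
    Tp A m ≃ₗ[ℤ] Tp A m :=
  PiTensorProduct.reindex ℤ (fun _ : Fin m => A) e

/-- The cyclic permutation `σ_m` on the tensor power, induced by reindexing along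
`x ↦ x + 1` on `Fin m`, so that `σ(a_1 ⊗ ⋯ ⊗ a_m) = a_m ⊗ a_1 ⊗ ⋯ ⊗ a_{m-1}`. -/
def sigmaT (A : Type*) [AddCommGroup A] (m : ℕ) [NeZero m] : Tp A m ≃ₗ[ℤ] Tp A m :=
  permT A m (Equiv.addRight (1 : Fin m))

/-- The norm (transfer) map `N_m = Σ_{s=0}^{m-1} σ_m^s` on the tensor power. -/
def normT (A : Type*) [AddCommGroup A] (m : ℕ) [NeZero m] : Tp A m → Tp A m :=
  fun x => ∑ s ∈ Finset.range m, (⇑(sigmaT A m))^[s] x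

/-- Identification of tensor powers of equal sizes. -/
def tcast {A : Type*} [AddCommGroup A] {a b : ℕ} (h : a = b) : Tp A a ≃ₗ[ℤ] Tp A b :=
  TensorPower.cast ℤ A h

/-- Flattening of an iterated tensor power: `(A^{⊗N})^{⊗q} ≃ A^{⊗(N·q)}`, grouping
consecutive blocks of length `N`. -/
def flattenE (A : Type*) [AddCommGroup A] (N : ℕ) : (q : ℕ) →
    (⨂[ℤ] _ : Fin q, Tp A N) ≃ₗ[ℤ] Tp A (N * q)
  | 0 => (PiTensorProduct.isEmptyEquiv (Fin 0)).trans
      (PiTensorProduct.isEmptyEquiv (Fin 0)).symm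
  | q + 1 =>
      (TensorPower.mulEquiv (R := ℤ) (M := Tp A N) (n := q) (m := 1)).symm.trans <|
      (TensorProduct.congr (flattenE A N q)
        (PiTensorProduct.subsingletonEquiv (0 : Fin 1))).trans <|
      TensorPower.mulEquiv (R := ℤ) (M := A) (n := N * q) (m := N)

/-- The elementary tensor `c^{⊗B} ∈ A^{⊗(N·B)}` whose `B` consecutive blocks of length `N`
all equal `c ∈ A^{⊗N}`. -/
def tpow {A : Type*} [AddCommGroup A] {N : ℕ} (c : Tp A N) (B : ℕ) : Tp A (N * B) :=
  flattenE A N B (PiTensorProduct.tprod ℤ (fun _ : Fin B => c))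

/-- `c^{⊗B}`, recast to live in `A^{⊗m}` along an identification `N * B = m`. -/
def tpowTo {A : Type*} [AddCommGroup A] {N : ℕ} (c : Tp A N) (B : ℕ) {m : ℕ}
    (h : N * B = m) : Tp A m :=
  tcast (A := A) h (tpow c B)

end Tensor

noncomputable section Frobenius

variable (p : ℕ) [NeZero p] {M : Type*} [AddCommGroup M]

/-- `φ^{⊗q}` : applies an additive map `φ : M → M^{⊗p}` to each of the `q` tensor factors,
the `p` outputs of each application of `φ` occupying a consecutive block of length `p`. -/
def frobT (φ : M →+ Tp M p) (q : ℕ) : Tp M q →ₗ[ℤ] Tp M (p * q) :=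
  (flattenE M p q).toLinearMap ∘ₗ
    PiTensorProduct.map (fun _ : Fin q => φ.toIntLinearMap)

/-- The higher Frobenius `φ_n : M^{⊗p^n} → M^{⊗p^{n+1}}`, the composite of `φ^{⊗p^n}`
(outputs of `φ` in the last base-`p` digit) followed by the action of the digit rotation
`τ_{n+1}`. -/
def higherFrob (φ : M →+ Tp M p) (n : ℕ) : Tp M (p ^ n) →ₗ[ℤ] Tp M (p ^ (n + 1)) :=
  (permT M (p ^ (n + 1)) (digitPerm p (n + 1) (rotPerm p (n + 1)))).toLinearMap ∘ₗ
    (tcast (A := M) (pow_succ' p n).symm).toLinearMap ∘ₗ frobT p φ (p ^ n)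

/-- An external Frobenius on an abelian group `M` (for the prime `p`): an additive map
`φ : M → M^{⊗p}` landing in the `σ_1`-invariants and congruent to `m ↦ m^{⊗p}` modulo the
image of the norm map `N_p = Σ_{s=0}^{p-1} σ_1^s`. -/
structure ExternalFrobenius (M : Type*) [AddCommGroup M] : Type _ where
  toFun : M →+ Tp M p
  fixed : ∀ m : M, sigmaT M p (toFun m) = toFun m
  congr_pow : ∀ m : M,
    toFun m - PiTensorProduct.tprod ℤ (fun _ : Fin p => m) ∈ Set.range (normT M p)

end Frobenius

section BlockReindexing

/-- `Fin p × Fin (p^n) ≃ Fin (p^(n+1))`, splitting off the most significant digit. -/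
def leadDigitEquiv (p n : ℕ) : Fin p × Fin (p ^ n) ≃ Fin (p ^ (n + 1)) :=
  finProdFinEquiv.trans (finCongr (pow_succ' p n).symm)

theorem leadDigitEquiv_val (p n : ℕ) (j : Fin p) (i : Fin (p ^ n)) :
    (leadDigitEquiv p n (j, i) : ℕ) = i + p ^ n * j := rfl

theorem msbEquiv_val (p m : ℕ) (f : Fin m → Fin p) :
    (msbEquiv p m f : ℕ) = ∑ i : Fin m, (f i.rev : ℕ) * p ^ (i : ℕ) := rfl

theorem rotPerm_apply (p m : ℕ) [NeZero m] (f : Fin m → Fin p) (k : Fin m) :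
    rotPerm p m f k = f (k - 1) := by
  rw [sub_eq_add_neg]
  rfl

theorem msbEquiv_succ_val (p n : ℕ) (f : Fin (n + 1) → Fin p) :
    (msbEquiv p (n + 1) f : ℕ) = f (Fin.last n) + p * msbEquiv p n (f ∘ Fin.castSucc) := by
  simp only [msbEquiv_val, Fin.sum_univ_succ, Fin.rev_zero, Fin.rev_succ, Fin.val_zero, pow_zero,
    mul_one, Fin.val_succ, pow_succ, Finset.mul_sum, Function.comp_apply]
  congr 1
  exact Finset.sum_congr rfl fun i _ => by ring

theorem msbEquiv_rotPerm_val (p n : ℕ) (f : Fin (n + 1) → Fin p) :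
    (msbEquiv p (n + 1) (rotPerm p (n + 1) f) : ℕ) =
      msbEquiv p n (f ∘ Fin.castSucc) + p ^ n * f (Fin.last n) := by
  have h0 : (0 : Fin (n + 1)) - 1 = Fin.last n := by
    rw [sub_eq_iff_eq_add, Fin.last_add_one]
  have h1 (i : Fin n) : i.succ - 1 = i.castSucc := by
    rw [sub_eq_iff_eq_add, Fin.coeSucc_eq_succ]
  simp only [msbEquiv_val, rotPerm_apply, Fin.sum_univ_castSucc, Fin.rev_castSucc, Fin.rev_last,
    h0, h1, Fin.val_castSucc, Fin.val_last, Function.comp_apply]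
  rw [mul_comm (p ^ n)]

/-- The digit rotation moves the last digit to the front. -/
theorem digitPerm_rotPerm (p n : ℕ) (i : Fin (p ^ n)) (j : Fin p) :
    digitPerm p (n + 1) (rotPerm p (n + 1))
        (Fin.cast ((mul_comm _ _).trans (pow_succ' p n).symm) (finProdFinEquiv (i, j))) =
      leadDigitEquiv p n (j, i) := by
  let f : Fin (n + 1) → Fin p := Fin.snoc (α := fun _ => Fin p) ((msbEquiv p n).symm i) j
  have hinit : f ∘ Fin.castSucc = (msbEquiv p n).symm i := by
    funext k
    simp [f]
  have hlast : f (Fin.last n) = j := by simp [f]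
  have hx : Fin.cast ((mul_comm _ _).trans (pow_succ' p n).symm) (finProdFinEquiv (i, j)) =
      msbEquiv p (n + 1) f := by
    ext
    rw [msbEquiv_succ_val, hinit, hlast, Equiv.apply_symm_apply]
    rfl
  rw [hx, digitPerm, Equiv.permCongr_apply, Equiv.symm_apply_apply]
  ext
  rw [msbEquiv_rotPerm_val, hinit, hlast, Equiv.apply_symm_apply, leadDigitEquiv_val]

theorem leadDigitEquiv_add_one (p n : ℕ) [NeZero p] (j : Fin p) (i : Fin (p ^ n)) :
    leadDigitEquiv p n (j, i) + 1 = leadDigitEquiv p n (if i + 1 = 0 then j + 1 else j, i + 1) := by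
  have hi : ((i + 1 : Fin (p ^ n)) : ℕ) = (i + 1) % p ^ n := by simp [Fin.val_add]
  have hj : ((j + 1 : Fin p) : ℕ) = (j + 1) % p := by simp [Fin.val_add]
  ext
  have hl : ((leadDigitEquiv p n (j, i) + 1 : Fin (p ^ (n + 1))) : ℕ) =
      (i + 1 + p ^ n * j) % (p ^ n * p) := by
    rw [← pow_succ, add_right_comm, ← leadDigitEquiv_val]
    simp [Fin.val_add]
  rw [hl, leadDigitEquiv_val, hi]
  rcases Nat.lt_or_ge (i + 1) (p ^ n) with h | h
  · have hne : i + 1 ≠ 0 := by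
      rw [Ne, Fin.ext_iff, hi, Nat.mod_eq_of_lt h]
      simp
    rw [if_neg hne, Nat.mod_eq_of_lt h, Nat.mod_eq_of_lt]
    calc (i : ℕ) + 1 + p ^ n * j < p ^ n + p ^ n * j := by gcongr
      _ = p ^ n * (j + 1) := by ring
      _ ≤ p ^ n * p := Nat.mul_le_mul_left _ j.isLt
  · have hq : (i : ℕ) + 1 = p ^ n := le_antisymm i.isLt h
    have h0 : i + 1 = 0 := by
      rw [Fin.ext_iff, hi, hq]
      simp
    rw [if_pos h0, hj, hq, Nat.mod_self, zero_add, ← Nat.mul_mod_mul_left]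
    congr 1
    ring

theorem leadDigitEquiv_sub_one (p n : ℕ) [NeZero p] (j : Fin p) (i : Fin (p ^ n)) :
    leadDigitEquiv p n (j, i) - 1 = leadDigitEquiv p n (if i = 0 then j - 1 else j, i - 1) := by
  rw [sub_eq_iff_eq_add, leadDigitEquiv_add_one]
  split_ifs <;> simp_all

end BlockReindexing

section TensorReindexing

variable {A : Type*} [AddCommGroup A]

theorem permT_tprod (m : ℕ) (e : Equiv.Perm (Fin m)) (f : Fin m → A) :
    permT A m e (PiTensorProduct.tprod ℤ f) = PiTensorProduct.tprod ℤ (fun i => f (e.symm i)) :=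
  PiTensorProduct.reindex_tprod _ _

theorem sigmaT_tprod (m : ℕ) [NeZero m] (f : Fin m → A) :
    sigmaT A m (PiTensorProduct.tprod ℤ f) = PiTensorProduct.tprod ℤ (fun i => f (i - 1)) := by
  simp only [sub_eq_add_neg]
  exact permT_tprod _ _ _

theorem mulEquiv_symm_tprod {n m : ℕ} (f : Fin (n + m) → A) :
    (TensorPower.mulEquiv (R := ℤ) (M := A) (n := n) (m := m)).symm (PiTensorProduct.tprod ℤ f) =
      PiTensorProduct.tprod ℤ (fun i => f (Fin.castAdd m i)) ⊗ₜ[ℤ]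
        PiTensorProduct.tprod ℤ (fun i => f (Fin.natAdd n i)) := by
  rw [LinearEquiv.symm_apply_eq]
  refine Eq.trans ?_ (TensorPower.tprod_mul_tprod ℤ _ _).symm
  rw [Fin.append_castAdd_natAdd]

theorem flattenE_tprod (N q : ℕ) (f : Fin (N * q) → A) :
    flattenE A N q (PiTensorProduct.tprod ℤ fun i => PiTensorProduct.tprod ℤ fun j =>
        f (Fin.cast (mul_comm q N) (finProdFinEquiv (i, j)))) =
      PiTensorProduct.tprod ℤ f := by
  induction q with
  | zero =>
    simp only [flattenE, LinearEquiv.trans_apply, PiTensorProduct.isEmptyEquiv_apply_tprod]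
    rw [LinearEquiv.symm_apply_eq]
    exact (PiTensorProduct.isEmptyEquiv_apply_tprod (Fin 0) f).symm
  | succ q ih =>
    simp only [flattenE, LinearEquiv.trans_apply]
    rw [mulEquiv_symm_tprod, TensorProduct.congr_tmul,
      PiTensorProduct.subsingletonEquiv_apply_tprod, ← LinearEquiv.eq_symm_apply]
    refine Eq.trans ?_ (mulEquiv_symm_tprod (n := N * q) (m := N) f).symm
    congr 1
    · rw [← ih]
      rfl
    · congr 1
      funext j
      congr 1
      ext
      simp [finProdFinEquiv, add_comm]

variable (A) in
/-- Flatten `p^n` blocks of length `p`, then rotate the digit inside the block to the front. -/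
noncomputable def rotFlatten (p n : ℕ) : (⨂[ℤ] _ : Fin (p ^ n), Tp A p) ≃ₗ[ℤ] Tp A (p ^ (n + 1)) :=
  (flattenE A p (p ^ n)).trans <| (tcast (A := A) (pow_succ' p n).symm).trans <|
    permT A (p ^ (n + 1)) (digitPerm p (n + 1) (rotPerm p (n + 1)))

theorem rotFlatten_tprod (p n : ℕ) (f : Fin (p ^ (n + 1)) → A) :
    rotFlatten A p n (PiTensorProduct.tprod ℤ fun i => PiTensorProduct.tprod ℤ fun j =>
        f (leadDigitEquiv p n (j, i))) =
      PiTensorProduct.tprod ℤ f := by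
  simp only [← digitPerm_rotPerm]
  simp only [rotFlatten, LinearEquiv.trans_apply]
  have h := flattenE_tprod p (p ^ n) fun x => f (digitPerm p (n + 1) (rotPerm p (n + 1))
    (Fin.cast (pow_succ' p n).symm x))
  simp only [Fin.cast_cast] at h
  rw [h, tcast, TensorPower.cast_tprod, permT_tprod]
  simp

/-- Conjugating `σ` by `rotFlatten` cyclically shifts the blocks and applies `σ` to the block that
wraps around. -/
theorem sigmaT_rotFlatten (p n : ℕ) [NeZero p] (x : ⨂[ℤ] _ : Fin (p ^ n), Tp A p) :
    sigmaT A (p ^ (n + 1)) (rotFlatten A p n x) =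
      rotFlatten A p n (PiTensorProduct.map
        (fun i => if i = 0 then (sigmaT A p).toLinearMap else LinearMap.id)
        (sigmaT (Tp A p) (p ^ n) x)) := by
  refine LinearMap.congr_fun (f := (sigmaT A (p ^ (n + 1))).toLinearMap ∘ₗ
    (rotFlatten A p n).toLinearMap) (g := (rotFlatten A p n).toLinearMap ∘ₗ PiTensorProduct.map
        (fun i => if i = 0 then (sigmaT A p).toLinearMap else LinearMap.id) ∘ₗ
        (sigmaT (Tp A p) (p ^ n)).toLinearMap) ?_ x
  refine PiTensorProduct.ext_of_span_eq_top
    (g := fun _ (a : Fin p → A) => PiTensorProduct.tprod ℤ a)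
    (fun _ => PiTensorProduct.span_tprod_eq_top) fun g => ?_
  obtain ⟨f, rfl⟩ : ∃ f : Fin (p ^ (n + 1)) → A, g = fun i j => f (leadDigitEquiv p n (j, i)) :=
    ⟨fun y => g ((leadDigitEquiv p n).symm y).2 ((leadDigitEquiv p n).symm y).1, by simp⟩
  simp only [LinearMap.comp_apply, LinearEquiv.coe_coe]
  rw [rotFlatten_tprod, sigmaT_tprod, sigmaT_tprod, PiTensorProduct.map_tprod,
    ← rotFlatten_tprod p n]
  congr 2
  funext i
  simp only [leadDigitEquiv_sub_one]
  split_ifs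
  · exact (sigmaT_tprod p fun j => f (leadDigitEquiv p n (j, i - 1))).symm
  · rfl

end TensorReindexing

theorem higherFrob_tprod (p : ℕ) [NeZero p] {M : Type*} [AddCommGroup M] (φ : M →+ Tp M p)
    (n : ℕ) (m : Fin (p ^ n) → M) :
    higherFrob p φ n (PiTensorProduct.tprod ℤ m) =
      rotFlatten M p n (PiTensorProduct.tprod ℤ fun i => φ (m i)) := by
  simp only [higherFrob, frobT, LinearMap.comp_apply, PiTensorProduct.map_tprod]
  rfl

theorem higherFrob_sigmaT (p : ℕ) [NeZero p] {M : Type*} [AddCommGroup M] (φ : M →+ Tp M p)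
    (hφ : ∀ m : M, sigmaT M p (φ m) = φ m) (n : ℕ) (x : Tp M (p ^ n)) :
    higherFrob p φ n (sigmaT M (p ^ n) x) = sigmaT M (p ^ (n + 1)) (higherFrob p φ n x) := by
  refine LinearMap.congr_fun (f := higherFrob p φ n ∘ₗ (sigmaT M (p ^ n)).toLinearMap)
    (g := (sigmaT M (p ^ (n + 1))).toLinearMap ∘ₗ higherFrob p φ n)
    (PiTensorProduct.ext (MultilinearMap.ext fun m => ?_)) x
  simp only [LinearMap.compMultilinearMap_apply, LinearMap.comp_apply, LinearEquiv.coe_coe]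
  rw [sigmaT_tprod, higherFrob_tprod, higherFrob_tprod, sigmaT_rotFlatten, sigmaT_tprod,
    PiTensorProduct.map_tprod]
  congr 2
  funext i
  split_ifs
  · exact (hφ _).symm
  · rfl

/-- let `p` be a prime, `M` an abelian group, and `φ : M → M^{⊗p}` an additive
map all of whose values are fixed by `σ_1`.  Then for every `n ≥ 1` (formulated at exponent
`n + 1`) the higher Frobenius `φ_n : M^{⊗p^n} → M^{⊗p^{n+1}}` satisfies
`φ_n ∘ σ_{p^n} = σ_{p^{n+1}} ∘ φ_n`; in particular it maps `σ`-invariant elements to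
`σ`-invariant elements. -/
theorem statement8 (p : ℕ) [NeZero p] (hp : p.Prime) (M : Type*) [AddCommGroup M]
    (φ : M →+ Tp M p) (hφ : ∀ m : M, sigmaT M p (φ m) = φ m) (n : ℕ) :
    (∀ x : Tp M (p ^ n),
        higherFrob p φ n (sigmaT M (p ^ n) x) = sigmaT M (p ^ (n + 1)) (higherFrob p φ n x))
      ∧ ∀ x : Tp M (p ^ n), sigmaT M (p ^ n) x = x →
        sigmaT M (p ^ (n + 1)) (higherFrob p φ n x) = higherFrob p φ n x := by
  refine ⟨higherFrob_sigmaT p φ hφ n, fun x hx => ?_⟩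
  rw [← higherFrob_sigmaT p φ hφ n, hx]
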